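/- Let U ⊆ ℝⁿ be open, let f : U → ℝᵐ be measurable, and let G : U → L(ℝⁿ, ℝᵐ) be a measurable map into the linear maps ℝⁿ → ℝᵐ such that x ↦ ‖G(x)‖ (operator norm) is locally integrable on U. Suppose that for every C¹-smooth compactly supported function u : ℝᵐ → ℝ, the composition u ∘ f is locally integrable on U and has a weak derivative given for almost every x ∈ U by ∇(u ∘ f)(x) = Du(f(x)) ∘ G(x), where Du is the classical derivative of u. Then f is locally integrable on U and G is a weak derivative of f; that is, f ∈ W^{1,1}_loc(U, ℝᵐ) with ∇f = G almost everywhere. -/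

import Mathlib

open MeasureTheory Filter Topology Set

/-- `G` is a weak derivative of `f` on the open set `U ⊆ ℝⁿ`:
`f` is locally integrable on `U`, `G` is measurable and locally integrable on `U`,
and the integration-by-parts identity holds against every smooth compactly
supported test function with support in `U`, in each coordinate direction. -/
def HasWeakDerivOn {n : ℕ} {F : Type*} [NormedAddCommGroup F] [NormedSpace ℝ F]
    (U : Set (EuclideanSpace ℝ (Fin n))) (f : EuclideanSpace ℝ (Fin n) → F)
    (G : EuclideanSpace ℝ (Fin n) → (EuclideanSpace ℝ (Fin n) →L[ℝ] F)) : Prop :=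
  LocallyIntegrableOn f U volume ∧
  AEStronglyMeasurable G (volume.restrict U) ∧
  LocallyIntegrableOn G U volume ∧
  ∀ φ : EuclideanSpace ℝ (Fin n) → ℝ, ContDiff ℝ (⊤ : ℕ∞) φ → HasCompactSupport φ →
    tsupport φ ⊆ U → ∀ i : Fin n,
      ∫ x in U, φ x • G x (EuclideanSpace.single i 1) =
        - ∫ x in U, (fderiv ℝ φ x (EuclideanSpace.single i 1)) • f x


open scoped Convolution ENNReal NNReal

lemma cw_integrable_smul {n : ℕ} {F : Type*} [NormedAddCommGroup F] [NormedSpace ℝ F]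
    {U : Set (EuclideanSpace ℝ (Fin n))} {φ : EuclideanSpace ℝ (Fin n) → ℝ}
    {H : EuclideanSpace ℝ (Fin n) → F}
    (hH : LocallyIntegrableOn H U volume) (hφ : Continuous φ) (hc : HasCompactSupport φ)
    (hs : tsupport φ ⊆ U) : Integrable (fun x => φ x • H x) := by
  have h1 : IntegrableOn (fun x => φ x • H x) (tsupport φ) :=
    (hH.integrableOn_compact_subset hs hc).continuousOn_smul hφ.continuousOn hc
  refine (integrableOn_iff_integrable_of_support_subset ?_).1 h1
  intro x hx
  apply subset_tsupport
  intro h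
  exact hx (by simp [h])

lemma cw_integrable_smul' {n : ℕ} {F : Type*} [NormedAddCommGroup F] [NormedSpace ℝ F]
    {U : Set (EuclideanSpace ℝ (Fin n))} {φ : EuclideanSpace ℝ (Fin n) → F}
    {H : EuclideanSpace ℝ (Fin n) → ℝ}
    (hH : LocallyIntegrableOn H U volume) (hφ : Continuous φ) (hc : HasCompactSupport φ)
    [SecondCountableTopology F]
    (hs : tsupport φ ⊆ U) : Integrable (fun x => H x • φ x) := by
  have h1 : IntegrableOn (fun x => H x • φ x) (tsupport φ) :=
    (hH.integrableOn_compact_subset hs hc).smul_continuousOn hφ.continuousOn hc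
  refine (integrableOn_iff_integrable_of_support_subset ?_).1 h1
  intro x hx
  apply subset_tsupport
  intro h
  exact hx (by simp [h])

/-- The integration by parts identity, as an identity of linear maps. -/
lemma cw_ibp {n : ℕ} {U : Set (EuclideanSpace ℝ (Fin n))}
    {g : EuclideanSpace ℝ (Fin n) → ℝ}
    {H : EuclideanSpace ℝ (Fin n) → (EuclideanSpace ℝ (Fin n) →L[ℝ] ℝ)}
    (hw : HasWeakDerivOn U g H) {φ : EuclideanSpace ℝ (Fin n) → ℝ}
    (hφ : ContDiff ℝ (⊤ : ℕ∞) φ) (hc : HasCompactSupport φ) (hs : tsupport φ ⊆ U) :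
    ∫ x in U, φ x • H x = - ∫ x in U, g x • fderiv ℝ φ x := by
  obtain ⟨hg, -, hH, hi⟩ := hw
  have i1 : Integrable (fun x => φ x • H x) (volume.restrict U) :=
    (cw_integrable_smul hH hφ.continuous hc hs).restrict
  have i2 : Integrable (fun x => g x • fderiv ℝ φ x) (volume.restrict U) :=
    (cw_integrable_smul' hg (hφ.continuous_fderiv (by simp)) (hc.fderiv ℝ)
      ((tsupport_fderiv_subset ℝ).trans hs)).restrict
  apply ContinuousLinearMap.coe_injective
  apply (EuclideanSpace.basisFun (Fin n) ℝ).toBasis.ext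
  intro i
  have := hi φ hφ hc hs i
  simp only [OrthonormalBasis.coe_toBasis, EuclideanSpace.basisFun_apply,
    ContinuousLinearMap.coe_coe, _root_.neg_apply]
  rw [ContinuousLinearMap.integral_apply i1, ContinuousLinearMap.integral_apply i2]
  simpa [mul_comm] using this

/-- Derivative of the mollification. -/
lemma cw_moll {n : ℕ} {U : Set (EuclideanSpace ℝ (Fin n))}
    {g : EuclideanSpace ℝ (Fin n) → ℝ}
    {H : EuclideanSpace ℝ (Fin n) → (EuclideanSpace ℝ (Fin n) →L[ℝ] ℝ)}
    (hw : HasWeakDerivOn U g H) (hg : LocallyIntegrable g)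
    {ρ : EuclideanSpace ℝ (Fin n) → ℝ} {ε : ℝ}
    (hφ : ContDiff ℝ (⊤ : ℕ∞) ρ) (hs : tsupport ρ ⊆ Metric.closedBall 0 ε)
    (x : EuclideanSpace ℝ (Fin n)) (hx : Metric.closedBall x ε ⊆ U) :
    HasFDerivAt (ρ ⋆[ContinuousLinearMap.lsmul ℝ ℝ, volume] g)
      (∫ z in U, ρ (x - z) • H z) x := by
  have hc : HasCompactSupport ρ :=
    HasCompactSupport.of_support_subset_isCompact (isCompact_closedBall 0 ε)
      ((subset_tsupport _).trans hs)
  have h1 := hc.hasFDerivAt_convolution_left (ContinuousLinearMap.lsmul ℝ ℝ)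
    (hφ.of_le (by simp)) hg x
  have hd : ∀ z, fderiv ℝ (fun z => ρ (x - z)) z = - fderiv ℝ ρ (x - z) := by
    intro z
    have := (((hφ.differentiable (by simp)) (x - z)).hasFDerivAt).comp z
      ((hasFDerivAt_id z).const_sub x)
    refine (HasFDerivAt.fderiv (f := fun z => ρ (x - z)) this).trans ?_
    ext; simp
  have hφ' : ContDiff ℝ (⊤ : ℕ∞) (fun z => ρ (x - z)) := by fun_prop
  have hsub : tsupport (fun z => ρ (x - z)) ⊆ Metric.closedBall x ε := by
    apply closure_minimal _ Metric.isClosed_closedBall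
    intro z hz
    have := hs (subset_tsupport _ (show x - z ∈ Function.support ρ from hz))
    simpa [dist_eq_norm, norm_sub_rev] using this
  have hc' : HasCompactSupport (fun z => ρ (x - z)) :=
    HasCompactSupport.of_support_subset_isCompact (isCompact_closedBall x ε)
      ((subset_tsupport _).trans hsub)
  refine h1.congr_fderiv (Eq.symm ?_)
  rw [cw_ibp hw hφ' hc' (hsub.trans hx), convolution_eq_swap,
    setIntegral_eq_integral_of_forall_compl_eq_zero, ← integral_neg]
  · congr 1
    ext z v
    rw [hd]
    simp [ContinuousLinearMap.precompL_apply, mul_comm]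
  · intro z hz
    have : z ∉ tsupport (fderiv ℝ (fun z => ρ (x - z))) := fun h =>
      hz (hx (hsub (tsupport_fderiv_subset ℝ h)))
    rw [image_eq_zero_of_notMem_tsupport this, smul_zero]

/-- Translation estimate for the mollification. -/
lemma cw_trans_moll {n : ℕ} {U : Set (EuclideanSpace ℝ (Fin n))}
    {g : EuclideanSpace ℝ (Fin n) → ℝ}
    {H : EuclideanSpace ℝ (Fin n) → (EuclideanSpace ℝ (Fin n) →L[ℝ] ℝ)}
    (hw : HasWeakDerivOn U g H) (hg : LocallyIntegrable g)
    {ρ : EuclideanSpace ℝ (Fin n) → ℝ} {r : ℝ}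
    {x₀ : EuclideanSpace ℝ (Fin n)} (hx₀ : Metric.ball x₀ (4 * r) ⊆ U)
    (hφ : ContDiff ℝ (⊤ : ℕ∞) ρ) (hs : tsupport ρ ⊆ Metric.closedBall 0 r)
    {k : EuclideanSpace ℝ (Fin n) → ℝ≥0∞} (hk : Measurable k)
    (hHk : ∀ᵐ z, z ∈ Metric.ball x₀ (4 * r) → ‖H z‖ₑ ≤ k z)
    {h : EuclideanSpace ℝ (Fin n)} (hh : ‖h‖ < 2 * r) :
    ∫⁻ x in Metric.ball x₀ r,
      ‖(ρ ⋆[ContinuousLinearMap.lsmul ℝ ℝ, volume] g) (x + h) -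
        (ρ ⋆[ContinuousLinearMap.lsmul ℝ ℝ, volume] g) x‖ₑ
      ≤ ‖h‖ₑ * ((∫⁻ x, ‖ρ x‖ₑ) * ∫⁻ z, k z) := by
  set γ := (ρ ⋆[ContinuousLinearMap.lsmul ℝ ℝ, volume] g) with hγ
  have hρc := hφ.continuous
  have hρm : Measurable ρ := hρc.measurable
  have hc : HasCompactSupport ρ :=
    HasCompactSupport.of_support_subset_isCompact (isCompact_closedBall 0 r)
      ((subset_tsupport _).trans hs)
  have hγs : ContDiff ℝ 1 γ := hc.contDiff_convolution_left _ (hφ.of_le (by simp)) hg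
  have key : ∀ x ∈ Metric.ball x₀ (3 * r), ‖fderiv ℝ γ x‖ₑ ≤ ∫⁻ z, ‖ρ (x - z)‖ₑ * k z := by
    intro x hx
    have hsub : Metric.closedBall x r ⊆ Metric.ball x₀ (4 * r) := by
      intro y hy
      simp only [Metric.mem_ball, Metric.mem_closedBall] at *
      linarith [dist_triangle y x x₀]
    rw [(cw_moll hw hg hφ hs x (hsub.trans hx₀)).fderiv]
    refine (enorm_integral_le_lintegral_enorm _).trans ?_
    refine (setLIntegral_le_lintegral _ _).trans ?_
    refine lintegral_mono_ae ?_
    filter_upwards [hHk] with z hz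
    rw [enorm_smul]
    by_cases h0 : ρ (x - z) = 0
    · simp [h0]
    · gcongr
      apply hz
      apply hsub
      have := hs (subset_tsupport _ (show x - z ∈ Function.support ρ from h0))
      simpa [dist_eq_norm, norm_sub_rev] using this
  have ftc : ∀ x ∈ Metric.ball x₀ r, ‖γ (x + h) - γ x‖ₑ ≤
      ∫⁻ t in Ioc (0 : ℝ) 1, ∫⁻ z, ‖h‖ₑ * (‖ρ (x + t • h - z)‖ₑ * k z) := by
    intro x hx
    have hd : ∀ t : ℝ, HasDerivAt (fun t : ℝ => γ (x + t • h)) (fderiv ℝ γ (x + t • h) h) t := by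
      intro t
      have h1 := ((hγs.differentiable (by simp)) (x + t • h)).hasFDerivAt
      have h2 : HasDerivAt (fun t : ℝ => x + t • h) h t := by
        simpa using ((hasDerivAt_id t).smul_const h).const_add x
      exact h1.comp_hasDerivAt t h2
    have hcont : Continuous (fun t : ℝ => fderiv ℝ γ (x + t • h) h) := by
      have := hγs.continuous_fderiv (by simp)
      fun_prop
    have := intervalIntegral.integral_eq_sub_of_hasDerivAt (a := 0) (b := 1)
      (fun t _ => hd t) (hcont.intervalIntegrable _ _)
    simp only [one_smul, zero_smul, add_zero] at this
    rw [← this, intervalIntegral.integral_of_le zero_le_one]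
    refine (enorm_integral_le_lintegral_enorm _).trans ?_
    refine setLIntegral_mono_ae' measurableSet_Ioc (ae_of_all _ ?_)
    intro t ht
    rw [lintegral_const_mul _ (by fun_prop), mul_comm]
    refine (ContinuousLinearMap.le_opENorm _ _).trans ?_
    gcongr
    apply key
    simp only [Metric.mem_ball, dist_eq_norm] at *
    have : ‖t • h‖ ≤ ‖h‖ := by
      rw [norm_smul, Real.norm_of_nonneg ht.1.le]
      nlinarith [ht.2, norm_nonneg h]
    calc ‖x + t • h - x₀‖ = ‖(x - x₀) + t • h‖ := by congr 1; abel
      _ ≤ _ := norm_add_le _ _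
      _ < _ := by linarith
  calc _ ≤ ∫⁻ x in Metric.ball x₀ r, ∫⁻ t in Ioc (0 : ℝ) 1, ∫⁻ z,
        ‖h‖ₑ * (‖ρ (x + t • h - z)‖ₑ * k z) :=
        setLIntegral_mono_ae' measurableSet_ball (ae_of_all _ ftc)
    _ ≤ ∫⁻ x, ∫⁻ t in Ioc (0 : ℝ) 1, ∫⁻ z,
        ‖h‖ₑ * (‖ρ (x + t • h - z)‖ₑ * k z) := setLIntegral_le_lintegral _ _
    _ = ∫⁻ t in Ioc (0 : ℝ) 1, ∫⁻ x, ∫⁻ z,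
        ‖h‖ₑ * (‖ρ (x + t • h - z)‖ₑ * k z) := by
        apply lintegral_lintegral_swap
        apply Measurable.aemeasurable
        apply Measurable.lintegral_prod_right' (f := fun p : (_ × ℝ) × _ =>
          ‖h‖ₑ * (‖ρ (p.1.1 + p.1.2 • h - p.2)‖ₑ * k p.2))
        fun_prop
    _ = ∫⁻ t in Ioc (0 : ℝ) 1, ‖h‖ₑ * ((∫⁻ x, ‖ρ x‖ₑ) * ∫⁻ z, k z) := by
        congr 1
        ext t
        rw [lintegral_lintegral_swap (by
          apply Measurable.aemeasurable
          unfold Function.uncurry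
          fun_prop)]
        rw [← lintegral_const_mul _ hk, ← lintegral_const_mul _ (by fun_prop)]
        congr 1
        ext z
        rw [lintegral_const_mul _ (by fun_prop), lintegral_mul_const _ (by fun_prop)]
        congr 2
        have := lintegral_add_right_eq_self (μ := volume) (fun x => ‖ρ x‖ₑ) (t • h - z)
        simpa [add_sub_assoc] using this
    _ = _ := by simp

/-- Translation estimate for weakly differentiable functions. -/
lemma cw_trans {n : ℕ} {U : Set (EuclideanSpace ℝ (Fin n))}
    {g : EuclideanSpace ℝ (Fin n) → ℝ}
    {H : EuclideanSpace ℝ (Fin n) → (EuclideanSpace ℝ (Fin n) →L[ℝ] ℝ)}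
    (hw : HasWeakDerivOn U g H) (hg : LocallyIntegrable g) {r : ℝ} (hr : 0 < r)
    {x₀ : EuclideanSpace ℝ (Fin n)} (hx₀ : Metric.ball x₀ (4 * r) ⊆ U)
    {k : EuclideanSpace ℝ (Fin n) → ℝ≥0∞} (hk : Measurable k)
    (hHk : ∀ᵐ z, z ∈ Metric.ball x₀ (4 * r) → ‖H z‖ₑ ≤ k z)
    {h : EuclideanSpace ℝ (Fin n)} (hh : ‖h‖ < 2 * r) :
    ∫⁻ x in Metric.ball x₀ r, ‖g (x + h) - g x‖ₑ ≤ ‖h‖ₑ * ∫⁻ z, k z := by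
  let φ : ℕ → ContDiffBump (0 : EuclideanSpace ℝ (Fin n)) := fun i =>
    ⟨r / (i + 1) / 2, r / (i + 1), by positivity, half_lt_self (by positivity)⟩
  have hrO : ∀ i, (φ i).rOut = r / (i + 1) := fun i => rfl
  have hrI : ∀ i, (φ i).rIn = r / (i + 1) / 2 := fun i => rfl
  have hlim : Tendsto (fun i => (φ i).rOut) atTop (𝓝 0) := by
    simp only [hrO]
    simpa [div_eq_mul_inv] using (tendsto_one_div_add_atTop_nhds_zero_nat (𝕜 := ℝ)).const_mul r
  have hconv := ContDiffBump.ae_convolution_tendsto_right_of_locallyIntegrable (μ := volume)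
    (K := 2) hlim (Eventually.of_forall fun i => by rw [hrO, hrI]; linarith) hg
  have hconv' := (quasiMeasurePreserving_add_right
    (volume : Measure (EuclideanSpace ℝ (Fin n))) h).ae hconv
  set γ : ℕ → EuclideanSpace ℝ (Fin n) → ℝ := fun i =>
    ((φ i).normed volume ⋆[ContinuousLinearMap.lsmul ℝ ℝ, volume] g) with hγ
  have hγc : ∀ i, Continuous (γ i) := fun i =>
    ((φ i).hasCompactSupport_normed.contDiff_convolution_left (n := 1) _
      (φ i).contDiff_normed hg).continuous
  calc ∫⁻ x in Metric.ball x₀ r, ‖g (x + h) - g x‖ₑ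
      = ∫⁻ x in Metric.ball x₀ r, liminf (fun i => ‖γ i (x + h) - γ i x‖ₑ) atTop := by
        apply lintegral_congr_ae
        apply ae_restrict_of_ae
        filter_upwards [hconv, hconv'] with x h1 h2
        exact ((h2.sub h1).enorm.liminf_eq).symm
    _ ≤ liminf (fun i => ∫⁻ x in Metric.ball x₀ r, ‖γ i (x + h) - γ i x‖ₑ) atTop := by
        apply lintegral_liminf_le
        intro i
        have := (hγc i).measurable
        fun_prop
    _ ≤ ‖h‖ₑ * ∫⁻ z, k z := by
        apply liminf_le_of_le (by isBoundedDefault)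
        intro b hb
        obtain ⟨i, hi⟩ := hb.exists
        refine hi.trans ?_
        have hle : (φ i).rOut ≤ r := by
          rw [hrO]; apply div_le_self hr.le; linarith [Nat.cast_nonneg (α := ℝ) i]
        refine (cw_trans_moll hw hg hx₀ (φ i).contDiff_normed
          ((φ i).tsupport_normed_eq.trans_subset (Metric.closedBall_subset_closedBall hle))
          hk hHk hh).trans ?_
        have : ∫⁻ x, ‖(φ i).normed volume x‖ₑ = 1 := by
          rw [← ofReal_integral_norm_eq_lintegral_enorm (φ i).integrable_normed]
          simp only [Real.norm_of_nonneg ((φ i).nonneg_normed _)]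
          rw [(φ i).integral_normed]; simp
        rw [this, one_mul]

/-- Cutoffs of the coordinate functions. -/
lemma cw_cutoff {m : ℕ} (j : Fin m) :
    ∃ u : ℕ → EuclideanSpace ℝ (Fin m) → ℝ, ∃ C : ℝ≥0,
      (∀ k, ContDiff ℝ 1 (u k)) ∧ (∀ k, HasCompactSupport (u k)) ∧
      (∀ k y, ‖fderiv ℝ (u k) y‖ ≤ C) ∧ (∀ k y, |u k y| ≤ ‖y‖) ∧
      (∀ y, Tendsto (fun k => u k y) atTop (𝓝 (y j))) ∧
      (∀ y, Tendsto (fun k => fderiv ℝ (u k) y) atTop (𝓝 (EuclideanSpace.proj j))) := by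
  let η : ContDiffBump (0 : EuclideanSpace ℝ (Fin m)) := ⟨1, 2, by norm_num, by norm_num⟩
  let P : EuclideanSpace ℝ (Fin m) →L[ℝ] ℝ := EuclideanSpace.proj j
  let w : EuclideanSpace ℝ (Fin m) → ℝ := fun y => η y * P y
  have hP : ∀ y, P y = y j := fun y => rfl
  have hw : ContDiff ℝ 1 w := η.contDiff.mul P.contDiff
  have hwc : HasCompactSupport w := η.hasCompactSupport.mul_right
  obtain ⟨C, hC⟩ := (hw.continuous_fderiv (by simp)).bounded_above_of_compact_support
    (hwc.fderiv ℝ)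
  have hC0 : 0 ≤ C := (norm_nonneg _).trans (hC 0)
  have hw1 : ∀ y, ‖y‖ < 1 → w y = P y := by
    intro y hy
    have : η y = 1 := η.one_of_mem_closedBall (by simpa using hy.le)
    simp [w, this]
  have hw1' : ∀ y, ‖y‖ < 1 → fderiv ℝ w y = P := by
    intro y hy
    have : w =ᶠ[𝓝 y] P := by
      filter_upwards [Metric.isOpen_ball.mem_nhds
        (show y ∈ Metric.ball (0 : EuclideanSpace ℝ (Fin m)) 1 by simpa using hy)] with z hz
      exact hw1 z (by simpa using hz)
    rw [this.fderiv_eq, P.fderiv]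
  have hws : ∀ y, |w y| ≤ ‖y‖ := by
    intro y
    rw [abs_mul, abs_of_nonneg η.nonneg, hP]
    have h1 : |y j| ≤ ‖y‖ := PiLp.norm_apply_le y j
    have := η.le_one (x := y)
    have := η.nonneg (x := y)
    nlinarith [abs_nonneg (y j), norm_nonneg y]
  have hNpos : ∀ k : ℕ, (0 : ℝ) < (k : ℝ) + 1 := fun k => by positivity
  have hd : ∀ (k : ℕ) y, HasFDerivAt (fun y => ((k : ℝ) + 1) * w (((k : ℝ) + 1)⁻¹ • y))
      (fderiv ℝ w (((k : ℝ) + 1)⁻¹ • y)) y := by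
    intro k y
    have h1 := ((hw.differentiable (by simp)) (((k : ℝ) + 1)⁻¹ • y)).hasFDerivAt
    have h2 := (h1.comp y ((hasFDerivAt_id y).const_smul (((k : ℝ) + 1)⁻¹))).const_mul
      ((k : ℝ) + 1)
    refine HasFDerivAt.congr_fderiv
      (f := fun y => ((k : ℝ) + 1) * w (((k : ℝ) + 1)⁻¹ • y)) h2 ?_
    ext v
    have := (hNpos k).ne'
    simp [mul_inv_cancel_left₀ this]
  have hev : ∀ y : EuclideanSpace ℝ (Fin m), ∀ᶠ k : ℕ in atTop, ‖((k : ℝ) + 1)⁻¹ • y‖ < 1 := by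
    intro y
    obtain ⟨N, hN⟩ := exists_nat_gt ‖y‖
    filter_upwards [eventually_ge_atTop N] with k hk
    rw [norm_smul, norm_inv, Real.norm_of_nonneg (hNpos k).le, inv_mul_lt_iff₀ (hNpos k)]
    have : (N : ℝ) ≤ k := by exact_mod_cast hk
    linarith
  refine ⟨fun k y => ((k : ℝ) + 1) * w (((k : ℝ) + 1)⁻¹ • y), ⟨C, hC0⟩, ?_, ?_, ?_, ?_, ?_, ?_⟩
  · intro k
    fun_prop
  · intro k
    apply HasCompactSupport.mul_left
    exact hwc.comp_smul (inv_ne_zero (hNpos k).ne')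
  · intro k y
    rw [(hd k y).fderiv]
    exact hC _
  · intro k y
    rw [abs_mul, abs_of_pos (hNpos k)]
    have := hws (((k : ℝ) + 1)⁻¹ • y)
    rw [norm_smul, norm_inv, Real.norm_of_nonneg (hNpos k).le] at this
    calc _ ≤ ((k : ℝ) + 1) * ((((k : ℝ) + 1)⁻¹) * ‖y‖) :=
          mul_le_mul_of_nonneg_left this (hNpos k).le
      _ = ‖y‖ := by have := (hNpos k).ne'; field_simp
  · intro y
    apply tendsto_const_nhds.congr'
    filter_upwards [hev y] with k hk
    rw [hw1 _ hk, hP]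
    have := (hNpos k).ne'
    simp
    field_simp
  · intro y
    apply tendsto_const_nhds.congr'
    filter_upwards [hev y] with k hk
    rw [(hd k y).fderiv, hw1' _ hk]

lemma cw_weak_congr {n : ℕ} {U : Set (EuclideanSpace ℝ (Fin n))}
    {g g' : EuclideanSpace ℝ (Fin n) → ℝ}
    {H : EuclideanSpace ℝ (Fin n) → (EuclideanSpace ℝ (Fin n) →L[ℝ] ℝ)}
    (hw : HasWeakDerivOn U g H) (hg : LocallyIntegrable g')
    (hgg : g =ᵐ[volume.restrict U] g') : HasWeakDerivOn U g' H := by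
  refine ⟨hg.locallyIntegrableOn _, hw.2.1, hw.2.2.1, ?_⟩
  intro φ h1 h2 h3 i
  rw [hw.2.2.2 φ h1 h2 h3 i]
  congr 1
  apply integral_congr_ae
  filter_upwards [hgg] with x hx
  rw [hx]

/-- Local integrability of one coordinate. -/
lemma cw_coord_integrable {n m : ℕ}
    {U : Set (EuclideanSpace ℝ (Fin n))}
    {f F : EuclideanSpace ℝ (Fin n) → EuclideanSpace ℝ (Fin m)}
    (hF : Measurable F) (hfF : f =ᵐ[volume.restrict U] F)
    {G : EuclideanSpace ℝ (Fin n) → (EuclideanSpace ℝ (Fin n) →L[ℝ] EuclideanSpace ℝ (Fin m))}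
    (hcolocal : ∀ u : EuclideanSpace ℝ (Fin m) → ℝ, ContDiff ℝ 1 u → HasCompactSupport u →
      HasWeakDerivOn U (u ∘ f) (fun x => (fderiv ℝ u (f x)).comp (G x)))
    {x₀ : EuclideanSpace ℝ (Fin n)} {r : ℝ} (hr : 0 < r)
    (hx₀ : Metric.ball x₀ (4 * r) ⊆ U) (hGi : IntegrableOn G (Metric.ball x₀ (4 * r)))
    (j : Fin m) : IntegrableOn (fun x => F x j) (Metric.ball x₀ r) := by
  obtain ⟨u, C, hu1, hu2, huC, hun, hut, -⟩ := cw_cutoff j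
  have hFj : Measurable (fun x => F x j) := by fun_prop
  -- the majorant
  obtain ⟨k0, hk0m, hk0⟩ := hGi.1.enorm
  have hk0fin : ∫⁻ z in Metric.ball x₀ (4 * r), k0 z < ∞ := by
    rw [← lintegral_congr_ae hk0]
    exact hGi.2
  set k : EuclideanSpace ℝ (Fin n) → ℝ≥0∞ :=
    fun z => C * (Metric.ball x₀ (4 * r)).indicator k0 z with hkdef
  have hkm : Measurable k := (hk0m.indicator measurableSet_ball).const_mul _
  have hkfin : ∫⁻ z, k z < ∞ := by
    rw [hkdef, lintegral_const_mul _ (hk0m.indicator measurableSet_ball),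
      lintegral_indicator measurableSet_ball]
    exact ENNReal.mul_lt_top ENNReal.coe_lt_top hk0fin
  have step : ∀ h : EuclideanSpace ℝ (Fin n), ‖h‖ < 2 * r →
      ∫⁻ x in Metric.ball x₀ r, ‖F (x + h) j - F x j‖ₑ ≤ ‖h‖ₑ * ∫⁻ z, k z := by
    intro h hh
    have each : ∀ i, ∫⁻ x in Metric.ball x₀ r, ‖u i (F (x + h)) - u i (F x)‖ₑ
        ≤ ‖h‖ₑ * ∫⁻ z, k z := by
      intro i
      obtain ⟨M, hM⟩ := (hu1 i).continuous.bounded_above_of_compact_support (hu2 i)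
      have hli : LocallyIntegrable (u i ∘ F) := by
        refine (locallyIntegrable_const M).mono
          ((hu1 i).continuous.measurable.comp hF).aestronglyMeasurable (ae_of_all _ fun x => ?_)
        exact (hM _).trans (le_abs_self M)
      have hw := cw_weak_congr (hcolocal (u i) (hu1 i) (hu2 i)) hli (by
        filter_upwards [hfF] with x hx
        simp [hx])
      refine cw_trans hw hli hr hx₀ hkm ?_ hh
      rw [← ae_restrict_iff' measurableSet_ball]
      filter_upwards [hk0, ae_restrict_mem measurableSet_ball] with z hz hzm
      rw [hkdef]
      simp only [indicator_of_mem hzm]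
      rw [← hz]
      have h1 : ‖(fderiv ℝ (u i) (f z)).comp (G z)‖ ≤ C * ‖G z‖ :=
        (ContinuousLinearMap.opNorm_comp_le _ _).trans
          (mul_le_mul_of_nonneg_right (huC i _) (norm_nonneg _))
      have h2 : ‖(fderiv ℝ (u i) (f z)).comp (G z)‖₊ ≤ C * ‖G z‖₊ := h1
      simp only [enorm_eq_nnnorm]
      exact_mod_cast h2
    calc ∫⁻ x in Metric.ball x₀ r, ‖F (x + h) j - F x j‖ₑ
        = ∫⁻ x in Metric.ball x₀ r, liminf (fun i => ‖u i (F (x + h)) - u i (F x)‖ₑ) atTop := by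
          congr 1
          ext x
          exact (((hut _).sub (hut _)).enorm.liminf_eq).symm
      _ ≤ liminf (fun i => ∫⁻ x in Metric.ball x₀ r, ‖u i (F (x + h)) - u i (F x)‖ₑ) atTop := by
          apply lintegral_liminf_le
          intro i
          have := (hu1 i).continuous.measurable
          fun_prop
      _ ≤ ‖h‖ₑ * ∫⁻ z, k z := by
          apply liminf_le_of_le (by isBoundedDefault)
          intro b hb
          obtain ⟨i, hi⟩ := hb.exists
          exact hi.trans (each i)
  have dbl : ∫⁻ h in Metric.ball (0 : EuclideanSpace ℝ (Fin n)) (2 * r),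
      ∫⁻ x in Metric.ball x₀ r, ‖F (x + h) j - F x j‖ₑ < ∞ := by
    calc _ ≤ ∫⁻ h in Metric.ball (0 : EuclideanSpace ℝ (Fin n)) (2 * r),
          ENNReal.ofReal (2 * r) * ∫⁻ z, k z := by
          refine setLIntegral_mono_ae' measurableSet_ball (ae_of_all _ ?_)
          intro h hh
          rw [mem_ball_zero_iff] at hh
          refine (step h hh).trans ?_
          gcongr
          rw [← ofReal_norm]
          exact ENNReal.ofReal_le_ofReal hh.le
      _ < ∞ := by
          rw [setLIntegral_const]
          exact ENNReal.mul_lt_top (ENNReal.mul_lt_top ENNReal.ofReal_lt_top hkfin)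
            measure_ball_lt_top
  rw [lintegral_lintegral_swap (by
    apply Measurable.aemeasurable
    unfold Function.uncurry
    fun_prop)] at dbl
  have hae := ae_lt_top (by
    apply Measurable.lintegral_prod_right' (f := fun p : _ × _ => ‖F (p.1 + p.2) j - F p.1 j‖ₑ)
    fun_prop) dbl.ne
  have hne : (volume.restrict (Metric.ball x₀ r)) ≠ 0 := by
    rw [Ne, Measure.restrict_eq_zero]
    exact (Metric.measure_ball_pos _ _ hr).ne'
  have : (ae (volume.restrict (Metric.ball x₀ r))).NeBot := ae_neBot.2 hne
  obtain ⟨x, hx, hxm⟩ := (hae.and (ae_restrict_mem measurableSet_ball)).exists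
  have hfin : ∫⁻ y in Metric.ball x₀ r, ‖F y j - F x j‖ₑ < ∞ := by
    refine lt_of_le_of_lt ?_ hx
    rw [← lintegral_indicator measurableSet_ball, ← lintegral_indicator measurableSet_ball,
      ← lintegral_add_left_eq_self _ x]
    apply lintegral_mono
    intro h
    by_cases hm : x + h ∈ Metric.ball x₀ r
    · have hm' : h ∈ Metric.ball (0 : EuclideanSpace ℝ (Fin n)) (2 * r) := by
        rw [mem_ball_zero_iff]
        rw [Metric.mem_ball] at hm hxm
        have := dist_triangle_right (x + h) x x₀
        simp only [dist_self_add_left] at this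
        linarith
      simp [indicator_of_mem hm, indicator_of_mem hm']
    · simp [indicator_of_notMem hm]
  have hi : IntegrableOn (fun y => F y j - F x j) (Metric.ball x₀ r) :=
    ⟨(hFj.sub_const _).aestronglyMeasurable, hfin⟩
  have hi2 : IntegrableOn (fun _ => F x j) (Metric.ball x₀ r) :=
    integrableOn_const measure_ball_lt_top.ne
  refine (Integrable.add hi hi2).congr (ae_of_all _ fun y => ?_)
  simp

/-- **Colocal weak differentiability implies weak differentiability (Euclidean case).**
Let `f : U → ℝᵐ` be measurable and let `G` be a measurable map into linear maps `ℝⁿ → ℝᵐ`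
whose operator norm is locally integrable on `U`. If for every `C¹`-smooth compactly
supported `u : ℝᵐ → ℝ` the composition `u ∘ f` is weakly differentiable on `U` with
weak derivative `x ↦ Du(f(x)) ∘ G(x)`, then `f` is locally integrable on `U` and `G` is
a weak derivative of `f`, i.e. `f ∈ W^{1,1}_loc(U, ℝᵐ)` with `∇f = G`. -/
theorem colocal_weak_derivative_implies_weak_derivative {n m : ℕ}
    {U : Set (EuclideanSpace ℝ (Fin n))} (hU : IsOpen U)
    {f : EuclideanSpace ℝ (Fin n) → EuclideanSpace ℝ (Fin m)}
    (hfm : AEMeasurable f (volume.restrict U))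
    {G : EuclideanSpace ℝ (Fin n) → (EuclideanSpace ℝ (Fin n) →L[ℝ] EuclideanSpace ℝ (Fin m))}
    (hGm : AEStronglyMeasurable G (volume.restrict U))
    (hGint : LocallyIntegrableOn G U volume)
    (hcolocal : ∀ u : EuclideanSpace ℝ (Fin m) → ℝ, ContDiff ℝ 1 u → HasCompactSupport u →
      HasWeakDerivOn U (u ∘ f) (fun x => (fderiv ℝ u (f x)).comp (G x))) :
    LocallyIntegrableOn f U volume ∧ HasWeakDerivOn U f G := by
  have hloc : LocallyIntegrableOn f U volume := by
    obtain ⟨F, hF, hfF⟩ := hfm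
    intro x₀ hx₀
    obtain ⟨R, hR, hRU⟩ := Metric.nhds_basis_closedBall.mem_iff.1 (hU.mem_nhds hx₀)
    have hr : 0 < R / 4 := by positivity
    have h4 : 4 * (R / 4) = R := by ring
    have hball : Metric.ball x₀ (4 * (R / 4)) ⊆ Metric.closedBall x₀ R := by
      rw [h4]; exact Metric.ball_subset_closedBall
    have hGi : IntegrableOn G (Metric.ball x₀ (4 * (R / 4))) :=
      (hGint.integrableOn_compact_subset hRU (isCompact_closedBall _ _)).mono_set hball
    have hc := fun j => cw_coord_integrable hF hfF hcolocal hr (hball.trans hRU) hGi j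
    have hFi : IntegrableOn F (Metric.ball x₀ (R / 4)) := by
      unfold IntegrableOn
      rw [integrable_piLp_iff]
      exact hc
    have hsub : Metric.ball x₀ (R / 4) ⊆ U :=
      (Metric.ball_subset_ball (by linarith)).trans (hball.trans hRU)
    have hfi : IntegrableOn f (Metric.ball x₀ (R / 4)) :=
      Integrable.congr hFi (ae_restrict_of_ae_restrict_of_subset hsub hfF.symm)
    exact ⟨_, mem_nhdsWithin_of_mem_nhds (Metric.ball_mem_nhds _ hr), hfi⟩
  refine ⟨hloc, hloc, hGm, hGint, ?_⟩
  intro φ hφ hc hs i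
  set e : EuclideanSpace ℝ (Fin n) := EuclideanSpace.single i 1 with he
  have i1 : Integrable (fun x => φ x • G x) (volume.restrict U) :=
    (cw_integrable_smul hGint hφ.continuous hc hs).restrict
  have i1' : Integrable (fun x => φ x • G x e) (volume.restrict U) := by
    simpa using i1.apply_continuousLinearMap e
  have hce : HasCompactSupport (fun x => fderiv ℝ φ x e) := hc.fderiv_apply (𝕜 := ℝ) e
  have hφe : Continuous (fun x => fderiv ℝ φ x e) := by
    have := hφ.continuous_fderiv (by simp)
    fun_prop
  have i2 : Integrable (fun x => fderiv ℝ φ x e • f x) (volume.restrict U) :=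
    (cw_integrable_smul hloc hφe hce ((tsupport_fderiv_apply_subset ℝ e).trans hs)).restrict
  ext j
  obtain ⟨u, C, hu1, hu2, huC, hun, hut, hud⟩ := cw_cutoff j
  have e1 : (∫ x in U, φ x • G x e) j = ∫ x in U, φ x * (G x e) j := by
    have := (EuclideanSpace.proj (𝕜 := ℝ) j).integral_comp_comm i1'
    simpa using this.symm
  have e2 : (∫ x in U, fderiv ℝ φ x e • f x) j = ∫ x in U, fderiv ℝ φ x e * f x j := by
    have := (EuclideanSpace.proj (𝕜 := ℝ) j).integral_comp_comm i2
    simpa using this.symm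
  rw [PiLp.neg_apply, e1, e2]
  have t1 : Tendsto (fun k => ∫ x in U, φ x * (fderiv ℝ (u k) (f x)) (G x e)) atTop
      (𝓝 (∫ x in U, φ x * (G x e) j)) := by
    refine tendsto_integral_of_dominated_convergence (fun x => C * ‖φ x • G x e‖) ?_
      (i1'.norm.const_mul _) ?_ ?_
    · intro k
      have hm := (hcolocal (u k) (hu1 k) (hu2 k)).2.1
      have := hm.apply_continuousLinearMap e
      exact hφ.continuous.aestronglyMeasurable.mul this
    · intro k
      refine ae_of_all _ fun x => ?_
      rw [norm_mul, norm_smul]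
      calc ‖φ x‖ * ‖(fderiv ℝ (u k) (f x)) (G x e)‖ ≤ ‖φ x‖ * (C * ‖G x e‖) := by
            gcongr
            exact (fderiv ℝ (u k) (f x)).le_of_opNorm_le (huC k _) _
        _ = _ := by ring
    · refine ae_of_all _ fun x => ?_
      refine Tendsto.const_mul _ ?_
      exact (ContinuousLinearMap.apply ℝ ℝ (G x e)).continuous.continuousAt.tendsto.comp
        (hud (f x))
  have t2 : Tendsto (fun k => ∫ x in U, fderiv ℝ φ x e * u k (f x)) atTop
      (𝓝 (∫ x in U, fderiv ℝ φ x e * f x j)) := by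
    refine tendsto_integral_of_dominated_convergence (fun x => ‖fderiv ℝ φ x e • f x‖) ?_
      i2.norm ?_ ?_
    · intro k
      exact hφe.aestronglyMeasurable.mul
        ((hu1 k).continuous.comp_aestronglyMeasurable hfm.aestronglyMeasurable)
    · intro k
      refine ae_of_all _ fun x => ?_
      rw [norm_mul, norm_smul]
      gcongr
      exact hun k _
    · exact ae_of_all _ fun x => (hut (f x)).const_mul _
  refine tendsto_nhds_unique t1 (t2.neg.congr fun k => ?_)
  have := (hcolocal (u k) (hu1 k) (hu2 k)).2.2.2 φ hφ hc hs i
  simp only [smul_eq_mul, ContinuousLinearMap.comp_apply, Function.comp_apply] at this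
  exact this.symm
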